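/- There is no regular language L over the symmetric alphabet X_H = {x^{±1}, y^{±1}, t^{±1}, τ^{±1}} such that every word of L is geodesic for H with respect to the weighted length, and the evaluation map from L to H is surjective. -/

import Mathlib

/-! Generators and presentations for the groups `H` and `G` of Neumann–Shapiro. -/

inductive GenH : Type
  | x | y | t | tau
  deriving DecidableEq

inductive GenG : Type
  | x | y | s | t
  deriving DecidableEq

namespace NS

open FreeGroup

/-- Conjugation `a^b = b⁻¹ a b` in a group. -/
def cnj {Γ : Type*} [Group Γ] (a b : Γ) : Γ := b⁻¹ * a * b

/-! ### The group `H` -/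

abbrev FH := FreeGroup GenH

def fx : FH := FreeGroup.of GenH.x
def fy : FH := FreeGroup.of GenH.y
def ft : FH := FreeGroup.of GenH.t
def ftau : FH := FreeGroup.of GenH.tau

/-- The eight elements `x, x^t, x^τ, x^{tτ}, y, y^t, y^τ, y^{tτ}` (as words). -/
def basisH : List FH :=
  [fx, cnj fx ft, cnj fx ftau, cnj fx (ft * ftau),
   fy, cnj fy ft, cnj fy ftau, cnj fy (ft * ftau)]

/-- Relators of `H`: `t² = τ² = [τ,t] = 1`, the eight elements of `basisH` pairwise
commute, and `x · x^τ = y · y^t`. -/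
def relsH : Set FH :=
  {ft ^ 2, ftau ^ 2, ftau⁻¹ * ft⁻¹ * ftau * ft} ∪
    {r | ∃ a ∈ basisH, ∃ b ∈ basisH, r = a * b * a⁻¹ * b⁻¹} ∪
    {fx * cnj fx ftau * (fy * cnj fy ft)⁻¹}

abbrev H := PresentedGroup relsH

def Hx : H := PresentedGroup.of GenH.x
def Hy : H := PresentedGroup.of GenH.y
def Ht : H := PresentedGroup.of GenH.t
def Htau : H := PresentedGroup.of GenH.tau

/-! ### The group `G` -/

abbrev FG := FreeGroup GenG

def gx : FG := FreeGroup.of GenG.x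
def gy : FG := FreeGroup.of GenG.y
def gs : FG := FreeGroup.of GenG.s
def gt : FG := FreeGroup.of GenG.t

/-- The eight conjugating elements `1, s, s², s³, t, ts, ts², ts³`. -/
def conjsG : List FG := [1, gs, gs ^ 2, gs ^ 3, gt, gt * gs, gt * gs ^ 2, gt * gs ^ 3]

/-- The sixteen elements `x^α, y^α` for `α ∈ {1, s, s², s³, t, ts, ts², ts³}`. -/
def basisG : List FG :=
  conjsG.map (fun b => cnj gx b) ++ conjsG.map (fun b => cnj gy b)

/-- Relators of `G`: `t² = s⁴ = [s,t] = 1`, the sixteen elements of `basisG` pairwise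
commute, and `x · x^{s²} = y · y^t`. -/
def relsG : Set FG :=
  {gt ^ 2, gs ^ 4, gs⁻¹ * gt⁻¹ * gs * gt} ∪
    {r | ∃ a ∈ basisG, ∃ b ∈ basisG, r = a * b * a⁻¹ * b⁻¹} ∪
    {gx * cnj gx (gs ^ 2) * (gy * cnj gy gt)⁻¹}

abbrev G := PresentedGroup relsG

def Gx : G := PresentedGroup.of GenG.x
def Gy : G := PresentedGroup.of GenG.y
def Gs : G := PresentedGroup.of GenG.s
def Gt : G := PresentedGroup.of GenG.t

/-! ### Words, evaluation, lengths, geodesics -/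

/-- A word over the symmetric alphabet on `α`: a letter `(a, true)` stands for the
generator `a` and `(a, false)` for its inverse. -/
abbrev Word (α : Type) := List (α × Bool)

/-- Evaluate a word in a group, given the images of the generators. -/
def evalWith {α : Type} {Γ : Type*} [Group Γ] (f : α → Γ) (w : Word α) : Γ :=
  (w.map fun p => if p.2 then f p.1 else (f p.1)⁻¹).prod

/-- Evaluation of a word over `X_H = {x^{±1}, y^{±1}, t^{±1}, τ^{±1}}` in `H`. -/
def evalH : Word GenH → H := evalWith (fun a => (PresentedGroup.of a : H))

/-- Evaluation of a word over `X = {x^{±1}, y^{±1}, t^{±1}, s^{±1}}` in `G`. -/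
def evalG : Word GenG → G := evalWith (fun a => (PresentedGroup.of a : G))

/-- Weight of a letter for `H`: the letters `x^{±1}, y^{±1}, t^{±1}` have length `1`
and `τ^{±1}` has length `2`. -/
def wtH : GenH × Bool → ℕ
  | (GenH.tau, _) => 2
  | _ => 1

/-- Weighted length of a word over `X_H`. -/
def wlenH (w : Word GenH) : ℕ := (w.map wtH).sum

/-- `ℓ(h)`: the minimum weighted length of a word over `X_H` evaluating to `h`. -/
noncomputable def ellH (h : H) : ℕ := sInf {n | ∃ w : Word GenH, evalH w = h ∧ wlenH w = n}

/-- A word over `X_H` is geodesic if its weighted length is `ℓ` of its evaluation. -/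
def IsGeodesicH (w : Word GenH) : Prop := wlenH w = ellH (evalH w)

/-- `ℓ_G(g)`: the minimum length (number of letters) of a word over `X` evaluating to `g`. -/
noncomputable def ellG (g : G) : ℕ := sInf {n | ∃ w : Word GenG, evalG w = g ∧ w.length = n}

/-- A word over `X` is geodesic if its length is `ℓ_G` of its evaluation. -/
def IsGeodesicG (w : Word GenG) : Prop := w.length = ellG (evalG w)

end NS

namespace NS

/-! ### Actions of `H` on `(ℤ/2)² × ℤ` -/

/-- Translation of the integer coordinate by an amount depending on the coset coordinates. -/
def translatePerm (f : Bool → Bool → ℤ) : Equiv.Perm (Bool × Bool × ℤ) where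
  toFun s := (s.1, s.2.1, s.2.2 + f s.1 s.2.1)
  invFun s := (s.1, s.2.1, s.2.2 - f s.1 s.2.1)
  left_inv s := by simp
  right_inv s := by simp

/-- The flip of the first coset coordinate, by which `t` acts. -/
def flipT : Equiv.Perm (Bool × Bool × ℤ) where
  toFun s := (!s.1, s.2.1, s.2.2)
  invFun s := (!s.1, s.2.1, s.2.2)
  left_inv s := by simp
  right_inv s := by simp

/-- The flip of the second coset coordinate, by which `τ` acts. -/
def flipTau : Equiv.Perm (Bool × Bool × ℤ) where
  toFun s := (s.1, !s.2.1, s.2.2)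
  invFun s := (s.1, !s.2.1, s.2.2)
  left_inv s := by simp
  right_inv s := by simp

/-- The action of the generators of `H` in which `x` and `y` translate by `f` and `k`. -/
def genPerm (f k : Bool → Bool → ℤ) : GenH → Equiv.Perm (Bool × Bool × ℤ)
  | .x => translatePerm f
  | .y => translatePerm k
  | .t => flipT
  | .tau => flipTau

lemma translatePerm_apply (f : Bool → Bool → ℤ) (s : Bool × Bool × ℤ) :
    translatePerm f s = (s.1, s.2.1, s.2.2 + f s.1 s.2.1) := rfl

lemma translatePerm_inv_apply (f : Bool → Bool → ℤ) (s : Bool × Bool × ℤ) :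
    (translatePerm f)⁻¹ s = (s.1, s.2.1, s.2.2 - f s.1 s.2.1) := rfl

lemma flipT_apply (s : Bool × Bool × ℤ) : flipT s = (!s.1, s.2.1, s.2.2) := rfl

lemma flipT_inv_apply (s : Bool × Bool × ℤ) : flipT⁻¹ s = (!s.1, s.2.1, s.2.2) := rfl

lemma flipTau_apply (s : Bool × Bool × ℤ) : flipTau s = (s.1, !s.2.1, s.2.2) := rfl

lemma flipTau_inv_apply (s : Bool × Bool × ℤ) : flipTau⁻¹ s = (s.1, !s.2.1, s.2.2) := rfl

lemma translatePerm_commute (f g : Bool → Bool → ℤ) :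
    Commute (translatePerm f) (translatePerm g) := by
  ext s <;> simp [translatePerm_apply, Equiv.Perm.mul_apply, add_right_comm]

lemma lift_basisH (f k : Bool → Bool → ℤ) {a : FH} (ha : a ∈ basisH) :
    ∃ g, FreeGroup.lift (genPerm f k) a = translatePerm g := by
  simp only [basisH, List.mem_cons, List.not_mem_nil, or_false] at ha
  rcases ha with h | h | h | h | h | h | h | h
  · exact ⟨f, by simp [h, fx, genPerm]⟩
  · exact ⟨fun p q => f (!p) q, by
      ext s <;> simp [h, fx, ft, cnj, genPerm, Equiv.Perm.mul_apply, translatePerm_apply,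
        flipT_apply, flipT_inv_apply]⟩
  · exact ⟨fun p q => f p (!q), by
      ext s <;> simp [h, fx, ftau, cnj, genPerm, Equiv.Perm.mul_apply, translatePerm_apply,
        flipTau_apply, flipTau_inv_apply]⟩
  · exact ⟨fun p q => f (!p) (!q), by
      ext s <;> simp [h, fx, ft, ftau, cnj, genPerm, Equiv.Perm.mul_apply, translatePerm_apply,
        flipT_apply, flipT_inv_apply, flipTau_apply, flipTau_inv_apply]⟩
  · exact ⟨k, by simp [h, fy, genPerm]⟩
  · exact ⟨fun p q => k (!p) q, by
      ext s <;> simp [h, fy, ft, cnj, genPerm, Equiv.Perm.mul_apply, translatePerm_apply,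
        flipT_apply, flipT_inv_apply]⟩
  · exact ⟨fun p q => k p (!q), by
      ext s <;> simp [h, fy, ftau, cnj, genPerm, Equiv.Perm.mul_apply, translatePerm_apply,
        flipTau_apply, flipTau_inv_apply]⟩
  · exact ⟨fun p q => k (!p) (!q), by
      ext s <;> simp [h, fy, ft, ftau, cnj, genPerm, Equiv.Perm.mul_apply, translatePerm_apply,
        flipT_apply, flipT_inv_apply, flipTau_apply, flipTau_inv_apply]⟩

/-- The weights `f` of the conjugates of `x` and `k` of the conjugates of `y` respect the
relation `x · x^τ = y · y^t` and its conjugates. -/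
def Compatible (f k : Bool → Bool → ℤ) : Prop :=
  ∀ p q, f p q + f p (!q) = k p q + k (!p) q

lemma lift_relsH {f k : Bool → Bool → ℤ} (hfk : Compatible f k) :
    ∀ r ∈ relsH, FreeGroup.lift (genPerm f k) r = 1 := by
  rintro r (((rfl | rfl | rfl) | ⟨a, ha, b, hb, rfl⟩) | rfl)
  · ext s <;> simp [ft, genPerm, pow_two, Equiv.Perm.mul_apply, flipT_apply]
  · ext s <;> simp [ftau, genPerm, pow_two, Equiv.Perm.mul_apply, flipTau_apply]
  · ext s <;> simp [ft, ftau, genPerm, Equiv.Perm.mul_apply, flipT_apply, flipT_inv_apply,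
      flipTau_apply, flipTau_inv_apply]
  · obtain ⟨g, hg⟩ := lift_basisH f k ha
    obtain ⟨g', hg'⟩ := lift_basisH f k hb
    rw [map_mul, map_mul, map_mul, map_inv, map_inv, hg, hg',
      (translatePerm_commute g g').eq, mul_inv_cancel_right, mul_inv_cancel]
  · rw [map_mul, map_inv, mul_inv_eq_one]
    ext s
    · simp [fx, fy, ft, ftau, cnj, genPerm, Equiv.Perm.mul_apply, translatePerm_apply,
        flipT_apply, flipT_inv_apply, flipTau_apply, flipTau_inv_apply]
    · simp [fx, fy, ft, ftau, cnj, genPerm, Equiv.Perm.mul_apply, translatePerm_apply,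
        flipT_apply, flipT_inv_apply, flipTau_apply, flipTau_inv_apply]
    · have := hfk s.1 s.2.1
      simp [fx, fy, ft, ftau, cnj, genPerm, Equiv.Perm.mul_apply, translatePerm_apply,
        flipT_apply, flipT_inv_apply, flipTau_apply, flipTau_inv_apply]
      linarith

/-- The action of `H` determined by compatible weights. -/
def actH {f k : Bool → Bool → ℤ} (hfk : Compatible f k) : H →* Equiv.Perm (Bool × Bool × ℤ) :=
  PresentedGroup.toGroup (lift_relsH hfk)

/-- One letter of a word acting on `(ℤ/2)² × ℤ`. -/
def letterStep (f k : Bool → Bool → ℤ) (c : GenH × Bool) (s : Bool × Bool × ℤ) :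
    Bool × Bool × ℤ :=
  match c with
  | (.x, true) => (s.1, s.2.1, s.2.2 + f s.1 s.2.1)
  | (.x, false) => (s.1, s.2.1, s.2.2 - f s.1 s.2.1)
  | (.y, true) => (s.1, s.2.1, s.2.2 + k s.1 s.2.1)
  | (.y, false) => (s.1, s.2.1, s.2.2 - k s.1 s.2.1)
  | (.t, _) => (!s.1, s.2.1, s.2.2)
  | (.tau, _) => (s.1, !s.2.1, s.2.2)

/-- The state reached from `(0, 0, 0)` when the letters of a word act from right to left. -/
def wordState (f k : Bool → Bool → ℤ) (w : Word GenH) : Bool × Bool × ℤ :=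
  w.foldr (letterStep f k) (false, false, 0)

lemma evalH_cons (c : GenH × Bool) (w : Word GenH) :
    evalH (c :: w) =
      (if c.2 then (PresentedGroup.of c.1 : H) else (PresentedGroup.of c.1)⁻¹) * evalH w := by
  simp [evalH, evalWith]

lemma evalH_append (u v : Word GenH) : evalH (u ++ v) = evalH u * evalH v := by
  simp [evalH, evalWith]

lemma evalH_replicate (m : ℕ) (a : GenH) :
    evalH (List.replicate m (a, true)) = (PresentedGroup.of a : H) ^ m := by
  simp [evalH, evalWith]

lemma actH_evalH {f k : Bool → Bool → ℤ} (hfk : Compatible f k) (w : Word GenH) :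
    actH hfk (evalH w) (false, false, 0) = wordState f k w := by
  induction w with
  | nil => simp [evalH, evalWith, wordState]
  | cons c w ih =>
    rw [evalH_cons, map_mul, Equiv.Perm.mul_apply, ih]
    rcases c with ⟨_ | _ | _ | _, _ | _⟩ <;>
      simp [actH, wordState, letterStep, genPerm, translatePerm_apply, translatePerm_inv_apply,
        flipT_apply, flipT_inv_apply, flipTau_apply, flipTau_inv_apply]

lemma wordState_congr {f k : Bool → Bool → ℤ} (hfk : Compatible f k) {v w : Word GenH}
    (h : evalH v = evalH w) : wordState f k v = wordState f k w := by
  rw [← actH_evalH hfk, ← actH_evalH hfk, h]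

/-! ### Length estimates -/

lemma wlenH_append (u v : Word GenH) : wlenH (u ++ v) = wlenH u + wlenH v := by
  simp [wlenH]

lemma wlenH_cons (c : GenH × Bool) (w : Word GenH) : wlenH (c :: w) = wtH c + wlenH w := by
  simp [wlenH]

lemma wlenH_replicate (m : ℕ) {c : GenH × Bool} (hc : wtH c = 1) :
    wlenH (List.replicate m c) = m := by
  simp [wlenH, hc]

lemma IsGeodesicH.wlenH_le {v w : Word GenH} (hw : IsGeodesicH w) (h : evalH v = evalH w) :
    wlenH w ≤ wlenH v := by
  rw [hw]
  exact Nat.sInf_le ⟨v, h, rfl⟩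

/-- The number of letters `t^{±1}` in a word. -/
def countT (w : Word GenH) : ℕ := w.countP (fun c => c.1 = GenH.t)

/-- The number of letters `τ^{±1}` in a word. -/
def countTau (w : Word GenH) : ℕ := w.countP (fun c => c.1 = GenH.tau)

lemma wordState_parity (f k : Bool → Bool → ℤ) (w : Word GenH) :
    ((wordState f k w).1 = false ↔ Even (countT w)) ∧
      ((wordState f k w).2.1 = false ↔ Even (countTau w)) := by
  induction w with
  | nil => simp [wordState, countT, countTau]
  | cons c w ih =>
    obtain ⟨h₁, h₂⟩ := ih
    rcases c with ⟨_ | _ | _ | _, _ | _⟩ <;>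
      simp_all [wordState, countT, countTau, letterStep, Nat.even_add_one]
    all_goals simp only [← Nat.not_even_iff_odd, ← h₁, ← h₂, Bool.not_eq_false]

/-- Weights under which each word without `τ` moves the integer coordinate by at most its length,
while `x^τ` has weight `3`. -/
def tauWeight (p q : Bool) : ℤ := if p then 1 else if q then 3 else -1

lemma compatible_tauWeight : Compatible tauWeight (fun _ _ => 1) := by
  intro p q
  cases p <;> cases q <;> rfl

lemma wordState_tauWeight_le {w : Word GenH} (hw : countTau w = 0) :
    (wordState tauWeight (fun _ _ => 1) w).2.1 = false ∧
      (wordState tauWeight (fun _ _ => 1) w).2.2 ≤ wlenH w := by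
  induction w with
  | nil => simp [wordState, wlenH]
  | cons c w ih =>
    have hw' : countTau w = 0 := by
      simp only [countTau, List.countP_cons] at hw ⊢
      omega
    obtain ⟨h₁, h₂⟩ := ih hw'
    rw [wlenH_cons]
    rw [wordState] at h₁ h₂ ⊢
    rw [List.foldr_cons]
    generalize List.foldr (letterStep tauWeight fun _ _ => 1) (false, false, 0) w = s at *
    obtain ⟨p, q, n⟩ := s
    subst h₁
    rcases c with ⟨_ | _ | _ | _, _ | _⟩ <;> cases p <;>
      simp_all [countTau, letterStep, tauWeight, wtH] <;> omega

lemma compatible_one : Compatible (fun _ _ => 1) (fun _ _ => 1) := fun _ _ => rfl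

lemma wordState_one_le (w : Word GenH) :
    (wordState (fun _ _ => 1) (fun _ _ => 1) w).2.2 + countT w + 2 * countTau w ≤ wlenH w := by
  induction w with
  | nil => simp [wordState, wlenH, countT, countTau]
  | cons c w ih =>
    rw [wlenH_cons]
    rcases c with ⟨_ | _ | _ | _, _ | _⟩ <;>
      simp_all [wordState, countT, countTau, letterStep, wtH] <;> omega

/-- Weights under which `x^{±1}` counts, but `y^{±1}` does not unless conjugated by `t`. -/
def yWeight (p _q : Bool) : ℤ := if p then 2 else 0

lemma compatible_yWeight : Compatible (fun _ _ => 1) yWeight := by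
  intro p q
  cases p <;> rfl

/-- The number of letters other than `x` and `τ^{±1}` in a word. -/
def countOther (w : Word GenH) : ℕ := w.countP (fun c => c ≠ (GenH.x, true) ∧ c.1 ≠ GenH.tau)

lemma wordState_yWeight_le {w : Word GenH} (hw : countT w = 0) :
    (wordState (fun _ _ => 1) yWeight w).1 = false ∧
      (wordState (fun _ _ => 1) yWeight w).2.2 + countOther w + 2 * countTau w ≤ wlenH w := by
  induction w with
  | nil => simp [wordState, wlenH, countOther, countTau]
  | cons c w ih =>
    have hw' : countT w = 0 := by
      simp only [countT, List.countP_cons] at hw ⊢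
      omega
    obtain ⟨h₁, h₂⟩ := ih hw'
    rw [wlenH_cons]
    rw [wordState] at h₁ h₂ ⊢
    rw [List.foldr_cons]
    generalize List.foldr (letterStep (fun _ _ => 1) yWeight) (false, false, 0) w = s at *
    obtain ⟨p, q, n⟩ := s
    subst h₁
    rcases c with ⟨_ | _ | _ | _, _ | _⟩ <;>
      simp_all [countT, countTau, countOther, letterStep, yWeight, wtH] <;> omega

/-! ### Words of the form `x^i τ^{±1} x^m τ^{±1} x^j` -/

/-- The word `x^i τ^{±1} x^m τ^{±1} x^j`. -/
def tauWord (i m j : ℕ) (e e' : Bool) : Word GenH :=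
  List.replicate i (GenH.x, true) ++ (GenH.tau, e) :: (List.replicate m (GenH.x, true) ++
    (GenH.tau, e') :: List.replicate j (GenH.x, true))

lemma foldr_letterStep_replicate (f k : Bool → Bool → ℤ) (m : ℕ) (p q : Bool) (n : ℤ) :
    (List.replicate m (GenH.x, true)).foldr (letterStep f k) (p, q, n) =
      (p, q, n + m * f p q) := by
  induction m with
  | zero => simp
  | succ m ih =>
    rw [List.replicate_succ, List.foldr_cons, ih]
    simp only [letterStep, Nat.cast_succ, Prod.mk.injEq, true_and]
    ring

lemma wordState_tauWord (f k : Bool → Bool → ℤ) (i m j : ℕ) (e e' : Bool) :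
    wordState f k (tauWord i m j e e') =
      (false, false, (i + j) * f false false + m * f false true) := by
  simp only [wordState, tauWord, List.foldr_append, List.foldr_cons, foldr_letterStep_replicate,
    letterStep, Bool.not_false, Bool.not_true, Prod.mk.injEq, true_and]
  ring

lemma wlenH_tauWord (i m j : ℕ) (e e' : Bool) : wlenH (tauWord i m j e e') = i + m + j + 4 := by
  simp only [tauWord, wlenH_append, wlenH_cons, wlenH_replicate _ (c := (GenH.x, true)) rfl, wtH]
  omega

lemma exists_eq_tauWord {w : Word GenH} (ho : countOther w = 0) (htau : countTau w = 2) :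
    ∃ i m j e e', w = tauWord i m j e e' := by
  have hsplit : ∀ v : Word GenH, countTau v ≠ 0 →
      ∃ u e r, v = u ++ (GenH.tau, e) :: r := by
    intro v hv
    obtain ⟨c, hc, hct⟩ := List.countP_pos_iff.1 (Nat.pos_of_ne_zero hv)
    obtain ⟨u, r, rfl⟩ := List.append_of_mem hc
    obtain ⟨g, e⟩ := c
    obtain rfl : g = GenH.tau := by simpa using hct
    exact ⟨u, e, r, rfl⟩
  have hrep : ∀ v : Word GenH, countOther v = 0 → countTau v = 0 →
      v = List.replicate v.length (GenH.x, true) := by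
    intro v hv hv'
    refine List.eq_replicate_iff.2 ⟨rfl, fun c hc => ?_⟩
    have h₁ := List.countP_eq_zero.1 hv c hc
    have h₂ := List.countP_eq_zero.1 hv' c hc
    simp only [decide_eq_true_eq] at h₁ h₂
    tauto
  obtain ⟨u, e, v, rfl⟩ := hsplit w (by omega)
  have hadd : ∀ (u r : Word GenH) (e : Bool),
      countTau (u ++ (GenH.tau, e) :: r) = countTau u + countTau r + 1 ∧
      countOther (u ++ (GenH.tau, e) :: r) = countOther u + countOther r := by
    intro u r e
    simp [countTau, countOther]
    omega
  rw [(hadd _ _ _).1] at htau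
  rw [(hadd _ _ _).2] at ho
  by_cases hv : countTau v = 0
  · obtain ⟨u₁, e₁, u₂, rfl⟩ := hsplit u (by omega)
    rw [(hadd _ _ _).1] at htau
    rw [(hadd _ _ _).2] at ho
    refine ⟨u₁.length, u₂.length, v.length, e₁, e, ?_⟩
    rw [tauWord, ← hrep u₁ (by omega) (by omega), ← hrep u₂ (by omega) (by omega),
      ← hrep v (by omega) (by omega)]
    simp
  · obtain ⟨u₁, e₁, u₂, rfl⟩ := hsplit v hv
    rw [(hadd _ _ _).1] at htau
    rw [(hadd _ _ _).2] at ho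
    refine ⟨u.length, u₁.length, u₂.length, e, e₁, ?_⟩
    rw [tauWord, ← hrep u (by omega) (by omega), ← hrep u₁ (by omega) (by omega),
      ← hrep u₂ (by omega) (by omega)]

/-- Weights measuring the exponent of `x^τ` in the abelian subgroup spanned by `x` and `x^τ`. -/
def conjWeight (_p q : Bool) : ℤ := if q then 1 else 0

lemma compatible_conjWeight : Compatible conjWeight (fun p _ => if p then 1 else 0) := by
  intro p q
  cases p <;> cases q <;> rfl

/-- Every word for `x^a (x^τ)^(a+3)` of length at most `2a + 7` is of the form
`x^i τ^{±1} x^(a+3) τ^{±1} x^j` with `i + j = a`. -/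
lemma eq_tauWord_of_evalH_eq {a : ℕ} {w : Word GenH}
    (hw : evalH w = evalH (tauWord a (a + 3) 0 true true)) (hlen : wlenH w ≤ 2 * a + 7) :
    ∃ i j e e', w = tauWord i (a + 3) j e e' ∧ i + j = a := by
  have htau : countTau w ≠ 0 := by
    intro h0
    have h := (wordState_tauWeight_le h0).2
    rw [wordState_congr compatible_tauWeight hw, wordState_tauWord] at h
    simp only [tauWeight] at h
    push_cast at h
    simp at h
    omega
  have hst := wordState_congr compatible_one hw
  rw [wordState_tauWord] at hst
  obtain ⟨hpt, hptau⟩ := wordState_parity (fun _ _ => 1) (fun _ _ => 1) w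
  rw [hst] at hpt hptau
  obtain ⟨m, hm⟩ := hptau.1 rfl
  obtain ⟨m', hm'⟩ := hpt.1 rfl
  have hle := wordState_one_le w
  rw [hst] at hle
  push_cast at hle
  have ht : countT w = 0 := by
    simp at hle
    omega
  have hle' := (wordState_yWeight_le ht).2
  rw [wordState_congr compatible_yWeight hw, wordState_tauWord] at hle'
  push_cast at hle'
  simp at hle'
  obtain ⟨i, n, j, e, e', rfl⟩ := exists_eq_tauWord (w := w) (by omega) (by omega)
  have hn := wordState_congr compatible_conjWeight hw
  rw [wordState_tauWord, wordState_tauWord] at hn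
  rw [wordState_tauWord] at hst
  simp [conjWeight] at hn hst
  obtain rfl : n = a + 3 := by omega
  exact ⟨i, j, e, e', rfl, by omega⟩

/-! ### A shorter word -/

lemma Htau_mul_self : Htau * Htau = 1 := by
  have h : (PresentedGroup.mk relsH) (ftau ^ 2) = 1 :=
    PresentedGroup.one_of_mem (by simp [relsH])
  rw [map_pow, pow_two] at h
  exact h

lemma Ht_mul_self : Ht * Ht = 1 := by
  have h : (PresentedGroup.mk relsH) (ft ^ 2) = 1 :=
    PresentedGroup.one_of_mem (by simp [relsH])
  rw [map_pow, pow_two] at h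
  exact h

lemma commute_of_mem_basisH {a b : FH} (ha : a ∈ basisH) (hb : b ∈ basisH) :
    Commute (PresentedGroup.mk relsH a) (PresentedGroup.mk relsH b) := by
  have h : (PresentedGroup.mk relsH) (a * b * a⁻¹ * b⁻¹) = 1 :=
    PresentedGroup.one_of_mem (Or.inl (Or.inr ⟨a, ha, b, hb, rfl⟩))
  rw [map_mul, map_mul, map_mul, map_inv, map_inv, mul_inv_eq_one, mul_inv_eq_iff_eq_mul] at h
  exact h

lemma commute_Hx_cnj : Commute Hx (cnj Hx Htau) :=
  commute_of_mem_basisH (a := fx) (b := cnj fx ftau) (by simp [basisH]) (by simp [basisH])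

lemma commute_Hy_cnj : Commute Hy (cnj Hy Ht) :=
  commute_of_mem_basisH (a := fy) (b := cnj fy ft) (by simp [basisH]) (by simp [basisH])

lemma Hx_mul_cnj : Hx * cnj Hx Htau = Hy * cnj Hy Ht := by
  have h : (PresentedGroup.mk relsH) (fx * cnj fx ftau * (fy * cnj fy ft)⁻¹) = 1 :=
    PresentedGroup.one_of_mem (Or.inr rfl)
  rw [map_mul, map_inv, mul_inv_eq_one] at h
  exact h

lemma cnj_pow_of_mul_self {Γ : Type*} [Group Γ] {b : Γ} (hb : b * b = 1) (a : Γ) (m : ℕ) :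
    cnj a b ^ m = b * a ^ m * b := by
  have hinv : b⁻¹ = b := inv_eq_of_mul_eq_one_left hb
  have h := conj_pow (a := b) (b := a) (i := m)
  rw [hinv] at h
  rw [cnj, hinv, h]

lemma ite_Htau (e : Bool) :
    (if e then (PresentedGroup.of GenH.tau : H) else (PresentedGroup.of GenH.tau)⁻¹) = Htau := by
  cases e
  · exact inv_eq_of_mul_eq_one_left Htau_mul_self
  · rfl

lemma evalH_tauWord (i m j : ℕ) (e e' : Bool) :
    evalH (tauWord i m j e e') = Hx ^ (i + j) * cnj Hx Htau ^ m := by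
  simp only [tauWord, evalH_append, evalH_cons, evalH_replicate, ite_Htau]
  change Hx ^ i * (Htau * (Hx ^ m * (Htau * Hx ^ j))) = _
  rw [pow_add, mul_assoc, (commute_Hx_cnj.pow_pow j m).eq, cnj_pow_of_mul_self Htau_mul_self]
  simp only [mul_assoc]

/-- The word `x^n y^m t y^m t`. -/
def tWord (n m : ℕ) : Word GenH :=
  List.replicate n (GenH.x, true) ++ (List.replicate m (GenH.y, true) ++
    (GenH.t, true) :: (List.replicate m (GenH.y, true) ++ [(GenH.t, true)]))

lemma wlenH_tWord (n m : ℕ) : wlenH (tWord n m) = n + 2 * m + 2 := by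
  simp only [tWord, wlenH_append, wlenH_cons, wlenH_replicate _ (c := (GenH.x, true)) rfl,
    wlenH_replicate _ (c := (GenH.y, true)) rfl, wtH]
  simp only [wlenH, List.map_nil, List.sum_nil]
  omega

lemma evalH_tWord (n m : ℕ) : evalH (tWord n m) = Hx ^ n * (Hx * cnj Hx Htau) ^ m := by
  rw [Hx_mul_cnj, commute_Hy_cnj.mul_pow, cnj_pow_of_mul_self Ht_mul_self]
  simp only [tWord, evalH_append, evalH_cons, evalH_replicate]
  have h : evalH [] = 1 := rfl
  simp only [h, if_true, mul_one, mul_assoc]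
  rfl

lemma not_isGeodesicH_tauWord {i m j : ℕ} (hm : m ≤ i + j) (e e' : Bool) :
    ¬ IsGeodesicH (tauWord i m j e e') := by
  intro h
  have heq : evalH (tWord (i + j - m) m) = evalH (tauWord i m j e e') := by
    rw [evalH_tWord, evalH_tauWord, commute_Hx_cnj.mul_pow, ← mul_assoc, ← pow_add,
      Nat.sub_add_cancel hm]
  have := h.wlenH_le heq
  rw [wlenH_tWord, wlenH_tauWord] at this
  omega

end NS

/-! ### Pumping -/

lemma DFA.evalFrom_replicate {α σ : Type*} (M : DFA α σ) (s : σ) (m : ℕ) (c : α) :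
    M.evalFrom s (List.replicate m c) = (fun r => M.step r c)^[m] s := by
  induction m generalizing s with
  | zero => rfl
  | succ m ih => rw [List.replicate_succ, DFA.evalFrom_cons, ih, Function.iterate_succ_apply]

/-- A sufficiently high iterate of a self-map of a finite type agrees, at a given point, with an
iterate lower by at least `d`. -/
lemma exists_iterate_eq_of_card {σ : Type*} [Fintype σ] (f : σ → σ) (s : σ) (d : ℕ) {m : ℕ}
    (hm : d * Fintype.card σ ≤ m) : ∃ m', m' + d ≤ m ∧ f^[m'] s = f^[m] s := by
  obtain ⟨i, j, hij, h⟩ : ∃ i j : Fin (Fintype.card σ + 1), i < j ∧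
      f^[d * i] s = f^[d * j] s := by
    obtain ⟨i, j, hij, h⟩ := Fintype.exists_ne_map_eq_of_card_lt
      (fun i : Fin (Fintype.card σ + 1) => f^[d * i] s) (by simp)
    rcases lt_or_gt_of_ne hij with hlt | hlt
    · exact ⟨i, j, hlt, h⟩
    · exact ⟨j, i, hlt, h.symm⟩
  have hj : d * j ≤ m := (Nat.mul_le_mul_left d (Nat.lt_succ_iff.1 j.2)).trans hm
  have hd : d * i + d ≤ d * j := by
    rw [← Nat.mul_succ]
    exact Nat.mul_le_mul_left d hij
  refine ⟨(m - d * j) + d * i, by omega, ?_⟩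
  rw [Function.iterate_add_apply, h, ← Function.iterate_add_apply, Nat.sub_add_cancel hj]


open NS in
/-- There is no regular language `L` over the symmetric alphabet
`X_H = {x^{±1}, y^{±1}, t^{±1}, τ^{±1}}` such that every word of `L` is geodesic for `H`
with respect to the weighted length and the evaluation map from `L` to `H` is surjective. -/
theorem no_regular_geodesic_language_surjecting_to_H :
    ¬ ∃ L : Language (GenH × Bool), L.IsRegular ∧ (∀ w ∈ L, IsGeodesicH w) ∧
      (∀ h : H, ∃ w ∈ L, evalH w = h) := by
  rintro ⟨L, ⟨σ, _, M, rfl⟩, hgeo, hsurj⟩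
  set a := 3 * Fintype.card σ with ha
  obtain ⟨w, hwL, hw⟩ := hsurj (evalH (tauWord a (a + 3) 0 true true))
  have hlen := (hgeo w hwL).wlenH_le hw.symm
  rw [wlenH_tauWord] at hlen
  obtain ⟨i, j, e, e', rfl, hij⟩ := eq_tauWord_of_evalH_eq hw (by omega)
  obtain ⟨m, hm, hiter⟩ := exists_iterate_eq_of_card (fun r => M.step r (GenH.x, true))
    (M.step (M.evalFrom M.start (List.replicate i (GenH.x, true))) (GenH.tau, e)) 3
    (m := a + 3) (by omega)
  refine not_isGeodesicH_tauWord (i := i) (m := m) (j := j) (by omega) e e' (hgeo _ ?_)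
  simp only [DFA.mem_accepts, DFA.eval, tauWord, DFA.evalFrom_of_append, DFA.evalFrom_cons,
    DFA.evalFrom_replicate] at hwL hiter ⊢
  rwa [hiter]
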